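/- arXiv:2102.06825 — 4 statements merged into one kernel-verified Lean document; each statement's English description precedes it below -/
import Mathlib

section
/- For every hypergraph H=(V,E) with N nodes, every confidence bound c > 0, every initial opinion state x(0) ∈ ℝ^N, and every sequence e_0, e_1, e_2, ... of hyperedges in E, the sequence of opinion states x(t) produced by the bounded-confidence update rule converges: the limit state x* = lim_{t→∞} x(t) exists in ℝ^N. -/
open MeasureTheory ProbabilityTheory Filter Finset
open scoped ENNReal NNReal

noncomputable section

/-- The discrete σ-algebra on finsets. -/
instance finsetMeasurableSpace {α : Type*} : MeasurableSpace (Finset α) := ⊤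

/-- The mean opinion of the nodes of a hyperedge `e`. -/
def hmean {N : ℕ} (e : Finset (Fin N)) (x : Fin N → ℝ) : ℝ :=
  (∑ i ∈ e, x i) / e.card

/-- The discordance of a hyperedge `e`: the unbiased sample variance of the
opinions of its nodes. -/
def disc {N : ℕ} (e : Finset (Fin N)) (x : Fin N → ℝ) : ℝ :=
  (∑ i ∈ e, (x i - hmean e x) ^ 2) / ((e.card : ℝ) - 1)

/-- One step of the bounded-confidence update rule with confidence bound `c`,
using the hyperedge `e`. -/
def bcmStep {N : ℕ} (c : ℝ) (e : Finset (Fin N)) (x : Fin N → ℝ) : Fin N → ℝ :=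
  if disc e x < c then (fun i => if i ∈ e then hmean e x else x i) else x

/-- The trajectory of the opinion state starting at `x0`, when the hyperedge
`es t` is selected at time `t`. -/
def bcmTraj {N : ℕ} (c : ℝ) (x0 : Fin N → ℝ) (es : ℕ → Finset (Fin N)) : ℕ → Fin N → ℝ
  | 0 => x0
  | t + 1 => bcmStep c (es t) (bcmTraj c x0 es t)

/-- A state `x` is absorbing for the hyperedge set `E` if every hyperedge is either
discordant or has all incident opinions equal. -/
def IsAbsorbing {N : ℕ} (c : ℝ) (E : Finset (Finset (Fin N))) (x : Fin N → ℝ) : Prop :=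
  ∀ e ∈ E, c ≤ disc e x ∨ ∀ i ∈ e, ∀ j ∈ e, x i = x j

/-- The hyperedge set of the complete hypergraph on `N` nodes. -/
def completeE (N : ℕ) : Finset (Finset (Fin N)) :=
  Finset.univ.filter fun e => 2 ≤ e.card

/-- The sample variance of the first `n` terms of a sequence of reals. -/
def sampleVar (n : ℕ) (x : ℕ → ℝ) : ℝ :=
  (∑ i ∈ Finset.range n, (x i - (∑ j ∈ Finset.range n, x j) / n) ^ 2) / ((n : ℝ) - 1)

/-- The sample variance of a finite family of reals. -/
def sampleVarFin {n : ℕ} (x : Fin n → ℝ) : ℝ :=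
  (∑ i, (x i - (∑ j, x j) / n) ^ 2) / ((n : ℝ) - 1)

/-- averaging over `e` -/
def avgP {N : ℕ} (e : Finset (Fin N)) (x : Fin N → ℝ) : Fin N → ℝ :=
  fun i => if i ∈ e then hmean e x else x i

/-- squared Euclidean norm -/
def enPhi {N : ℕ} (x : Fin N → ℝ) : ℝ := ∑ i, x i ^ 2

lemma avgP_sub {N : ℕ} (e : Finset (Fin N)) (x y : Fin N → ℝ) :
    avgP e (x - y) = avgP e x - avgP e y := by
  funext i
  simp only [avgP, hmean, Pi.sub_apply]
  split_ifs
  · rw [Finset.sum_sub_distrib]; ring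
  · rfl

lemma avgP_cont {N : ℕ} (e : Finset (Fin N)) : Continuous (avgP e) := by
  refine continuous_pi fun i => ?_
  unfold avgP hmean
  by_cases h : i ∈ e
  · simp only [h, if_true]; fun_prop
  · simp only [h, if_false]; fun_prop

lemma enPhi_cont {N : ℕ} : Continuous (enPhi (N := N)) := by
  unfold enPhi; fun_prop

lemma enPhi_avg {N : ℕ} (e : Finset (Fin N)) (x : Fin N → ℝ) :
    enPhi x = enPhi (avgP e x) + enPhi (x - avgP e x) := by
  have key : ∑ i, (x i - avgP e x i) * avgP e x i = 0 := by
    have h1 : ∀ i, (x i - avgP e x i) * avgP e x i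
        = if i ∈ e then (x i - hmean e x) * hmean e x else 0 := by
      intro i; unfold avgP; split_ifs <;> ring
    rw [Finset.sum_congr rfl fun i _ => h1 i, Finset.sum_ite_mem, Finset.univ_inter,
      ← Finset.sum_mul, Finset.sum_sub_distrib, Finset.sum_const, nsmul_eq_mul]
    rcases e.eq_empty_or_nonempty with rfl | he
    · simp
    · have : (e.card : ℝ) ≠ 0 := by exact_mod_cast he.card_pos.ne'
      have h2 : (e.card : ℝ) * hmean e x = ∑ i ∈ e, x i := by
        unfold hmean; field_simp
      rw [h2]; ring
  have : enPhi x = enPhi (avgP e x) + enPhi (x - avgP e x)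
      + 2 * ∑ i, (x i - avgP e x i) * avgP e x i := by
    unfold enPhi
    rw [Finset.mul_sum, ← Finset.sum_add_distrib, ← Finset.sum_add_distrib]
    refine Finset.sum_congr rfl fun i _ => ?_
    simp only [Pi.sub_apply]; ring
  rw [this, key]; ring

lemma enPhi_nonneg {N : ℕ} (x : Fin N → ℝ) : 0 ≤ enPhi x :=
  Finset.sum_nonneg fun i _ => sq_nonneg _

lemma enPhi_pos {N : ℕ} (x : Fin N → ℝ) (h : x ≠ 0) : 0 < enPhi x := by
  obtain ⟨i, hi⟩ := Function.ne_iff.1 h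
  exact Finset.sum_pos' (fun i _ => sq_nonneg _) ⟨i, Finset.mem_univ _, by
    have : x i ≠ 0 := hi
    positivity⟩

lemma norm_le_enPhi {N : ℕ} (x : Fin N → ℝ) : ‖x‖ ≤ Real.sqrt (enPhi x) := by
  refine (pi_norm_le_iff_of_nonneg (Real.sqrt_nonneg _)).2 fun i => ?_
  rw [Real.norm_eq_abs]
  refine Real.abs_le_sqrt ?_
  exact Finset.single_le_sum (f := fun i => x i ^ 2) (fun i _ => sq_nonneg _) (Finset.mem_univ i)

lemma tendsto_of_enPhi {N : ℕ} (y : ℕ → Fin N → ℝ) (z : Fin N → ℝ)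
    (h : Tendsto (fun n => enPhi (y n - z)) atTop (nhds 0)) : Tendsto y atTop (nhds z) := by
  rw [tendsto_iff_norm_sub_tendsto_zero]
  refine squeeze_zero (fun _ => norm_nonneg _) (fun n => norm_le_enPhi _) ?_
  simpa [Function.comp_def] using (Real.continuous_sqrt.tendsto 0).comp h

/-- any sequence of averaging steps converges -/
lemma avg_conv {N : ℕ} (x : ℕ → Fin N → ℝ) (u : ℕ → Finset (Fin N))
    (hx : ∀ t, x (t + 1) = avgP (u t) (x t)) : ∃ L, Tendsto x atTop (nhds L) := by
  have anti : Antitone fun t => enPhi (x t) := antitone_nat_of_succ_le fun t => by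
    have := enPhi_avg (u t) (x t)
    have := enPhi_nonneg (x t - avgP (u t) (x t))
    rw [hx]; linarith
  obtain ⟨z, -, φ, hφ, hz⟩ := tendsto_subseq_of_bounded
    (Metric.isBounded_closedBall (x := (0 : Fin N → ℝ)) (r := Real.sqrt (enPhi (x 0))))
    (x := x) (fun t => by
      rw [mem_closedBall_zero_iff]
      exact (norm_le_enPhi _).trans (Real.sqrt_le_sqrt (anti (Nat.zero_le t))))
  have hDφ : Tendsto (fun n => enPhi (x (φ n) - z)) atTop (nhds 0) := by
    have h1 : Tendsto (fun n => x (φ n) - z) atTop (nhds (z - z)) := hz.sub_const z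
    have h2 := (enPhi_cont.tendsto (z - z)).comp h1
    simpa [enPhi, Function.comp_def] using h2
  have low : ∀ t, enPhi z ≤ enPhi (x t) := fun t => by
    refine le_of_tendsto ((enPhi_cont.tendsto z).comp hz) ?_
    filter_upwards [eventually_ge_atTop t] with n hn
    exact anti (hn.trans (hφ.id_le n))
  have step : ∀ t, avgP (u t) z = z → enPhi (x (t + 1) - z) ≤ enPhi (x t - z) := fun t ht => by
    have h1 := enPhi_avg (u t) (x t - z)
    have h2 := enPhi_nonneg (x t - z - avgP (u t) (x t - z))
    rw [avgP_sub, ht, ← hx] at h1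
    rw [avgP_sub, ht, ← hx] at h2
    linarith
  have mono : ∀ a b, a ≤ b → (∀ t, a ≤ t → t < b → avgP (u t) z = z) →
      enPhi (x b - z) ≤ enPhi (x a - z) := by
    intro a b hab
    induction b, hab using Nat.le_induction with
    | base => intro _; exact le_rfl
    | succ b hb ih =>
      intro h
      exact (step b (h b hb (Nat.lt_succ_self b))).trans
        (ih fun t h1 h2 => h t h1 (h2.trans (Nat.lt_succ_self b)))
  have near : ∀ᶠ y in nhds z, ∀ e : Finset (Fin N), avgP e z ≠ z → enPhi (avgP e y) < enPhi z := by
    rw [eventually_all]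
    intro e
    by_cases he : avgP e z = z
    · simp [he]
    · have h1 := enPhi_avg e z
      have h2 := enPhi_pos (z - avgP e z) (sub_ne_zero.2 (Ne.symm he))
      have h3 : enPhi (avgP e z) < enPhi z := by linarith
      have h4 := (enPhi_cont.comp (avgP_cont e)).tendsto z
      filter_upwards [h4.eventually_lt_const h3] with y hy _
      exact hy
  have ev : ∀ᶠ t in atTop, avgP (u t) z = z := by
    by_contra hcon
    have hf : ∀ a, ∃ s, a ≤ s ∧ avgP (u s) z ≠ z := by
      intro a
      obtain ⟨s, h1, h2⟩ := (frequently_atTop.1 (not_eventually.1 hcon)) a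
      exact ⟨s, h1, h2⟩
    have hs : ∀ n, ∃ s, avgP (u s) z ≠ z ∧ enPhi (x s - z) ≤ enPhi (x (φ n) - z) := by
      intro n
      classical
      have hsp := Nat.find_spec (hf (φ n))
      refine ⟨Nat.find (hf (φ n)), hsp.2, mono _ _ hsp.1 fun t h1 h2 => ?_⟩
      by_contra h3
      exact Nat.find_min (hf (φ n)) h2 ⟨h1, h3⟩
    choose s hs1 hs2 using hs
    have hlim : Tendsto (fun n => x (s n)) atTop (nhds z) :=
      tendsto_of_enPhi _ _ (squeeze_zero (fun _ => enPhi_nonneg _) hs2 hDφ)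
    obtain ⟨n, hn⟩ := (hlim.eventually near).exists
    have h1 := hn _ (hs1 n)
    rw [← hx] at h1
    exact absurd (low (s n + 1)) (not_le.2 h1)
  obtain ⟨T, hT⟩ := eventually_atTop.1 ev
  refine ⟨z, tendsto_of_enPhi _ _ ?_⟩
  rw [tendsto_order]
  refine ⟨fun a ha => Eventually.of_forall fun n => ha.trans_le (enPhi_nonneg _), fun a ha => ?_⟩
  obtain ⟨n, hn1, hn2⟩ := ((hDφ.eventually_lt_const ha).and (eventually_ge_atTop T)).exists
  filter_upwards [eventually_ge_atTop (φ n)] with t ht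
  exact (mono _ _ ht fun r h1 _ => hT r (hn2.trans ((hφ.id_le n).trans h1))).trans_lt hn1

/-- For every hypergraph on `N` nodes, confidence bound `c > 0`,
initial opinion state, and sequence of hyperedges from `E`, the sequence of opinion
states produced by the bounded-confidence update rule converges to some limit state. -/
theorem stmt0 (N : ℕ) (E : Finset (Finset (Fin N))) (hE : ∀ e ∈ E, 2 ≤ e.card)
    (c : ℝ) (hc : 0 < c) (x0 : Fin N → ℝ)
    (es : ℕ → Finset (Fin N)) (hes : ∀ t, es t ∈ E) :
    ∃ L : Fin N → ℝ, Tendsto (bcmTraj c x0 es) atTop (nhds L) := by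
  refine avg_conv _ (fun t => if disc (es t) (bcmTraj c x0 es t) < c then es t else ∅) fun t => ?_
  change bcmStep c (es t) (bcmTraj c x0 es t) = _
  unfold bcmStep
  split_ifs
  · rfl
  · funext i; simp [avgP]

end
end

section
/- Let H=(V,E) be a hypergraph, let ψ: V → {1,...,k} be a partition of the nodes into k communities, and let M ≥ 2 be such that every hyperedge e ∈ E that is not contained in a single community satisfies |e| ≤ M. Let γ_1, ..., γ_k ∈ ℝ and let x* be the polarized opinion state with x*_i = γ_{ψ(i)} for all i. If (γ_i − γ_j)²/M > c for every pair i, j with γ_i ≠ γ_j, then x* is an absorbing state. -/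
open MeasureTheory ProbabilityTheory Filter Finset
open scoped ENNReal NNReal

noncomputable section

theorem aux_double {N : ℕ} (e : Finset (Fin N)) (f : Fin N → ℝ) :
    ∑ i ∈ e, ∑ j ∈ e, (f i - f j) ^ 2 =
      2 * ((e.card : ℝ) * ∑ i ∈ e, f i ^ 2 - (∑ i ∈ e, f i) ^ 2) := by
  have h : ∀ i j, (f i - f j) ^ 2 = f i ^ 2 - 2 * (f i * f j) + f j ^ 2 := fun i j => by ring
  simp only [h, Finset.sum_add_distrib, Finset.sum_sub_distrib, Finset.sum_const, nsmul_eq_mul,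
    ← Finset.mul_sum, ← Finset.sum_mul]
  ring

theorem aux_mean {N : ℕ} (e : Finset (Fin N)) (f : Fin N → ℝ) (he : (e.card : ℝ) ≠ 0) :
    (e.card : ℝ) * ∑ i ∈ e, (f i - hmean e f) ^ 2 =
      (e.card : ℝ) * ∑ i ∈ e, f i ^ 2 - (∑ i ∈ e, f i) ^ 2 := by
  have h : ∀ i m, (f i - m) ^ 2 = f i ^ 2 - 2 * (f i * m) + m ^ 2 := fun i j => by ring
  simp only [h, Finset.sum_add_distrib, Finset.sum_sub_distrib, Finset.sum_const, nsmul_eq_mul,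
    ← Finset.mul_sum, ← Finset.sum_mul]
  unfold hmean
  field_simp
  ring

/-- Suppose every hyperedge of `H` that is not contained in a single
community of the partition `ψ` has at most `M` nodes, and let `x*` be the polarized
state assigning opinion `γ_{ψ(i)}` to node `i`. If `(γ_i − γ_j)²/M > c` for every pair
with `γ_i ≠ γ_j`, then `x*` is an absorbing state. -/
theorem stmt11 (N k : ℕ) (E : Finset (Finset (Fin N))) (hE : ∀ e ∈ E, 2 ≤ e.card)
    (c : ℝ) (hc : 0 < c) (ψ : Fin N → Fin k) (M : ℕ) (hM : 2 ≤ M)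
    (hinter : ∀ e ∈ E, (¬ ∃ j, ∀ i ∈ e, ψ i = j) → e.card ≤ M)
    (γ : Fin k → ℝ) (hgap : ∀ i j, γ i ≠ γ j → c < (γ i - γ j) ^ 2 / M) :
    IsAbsorbing c E (fun i => γ (ψ i)) := by
  intro e he
  by_cases hall : ∀ i ∈ e, ∀ j ∈ e, γ (ψ i) = γ (ψ j)
  · exact Or.inr hall
  left
  push Not at hall
  obtain ⟨p, hp, q, hq, hpq⟩ := hall
  have hcard : e.card ≤ M := by
    apply hinter e he
    rintro ⟨j, hj⟩
    exact hpq (by rw [hj p hp, hj q hq])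
  have h2 : (2 : ℝ) ≤ e.card := by exact_mod_cast hE e he
  have hnM : (e.card : ℝ) ≤ M := by exact_mod_cast hcard
  set x : Fin N → ℝ := fun i => γ (ψ i) with hx
  have hMpos : (0 : ℝ) < M := by linarith
  have hg : ∀ i j, x i ≠ x j → c * M ≤ (x i - x j) ^ 2 := by
    intro i j hij
    have := hgap (ψ i) (ψ j) hij
    rw [lt_div_iff₀ hMpos] at this
    exact this.le
  classical
  set g : Fin N → ℝ := fun i => if x i = x p then 1 else 0 with hgdef
  have hle : ∑ i ∈ e, ∑ j ∈ e, (c * M) * (g i - g j) ^ 2 ≤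
      ∑ i ∈ e, ∑ j ∈ e, (x i - x j) ^ 2 := by
    refine Finset.sum_le_sum fun i _ => Finset.sum_le_sum fun j _ => ?_
    by_cases hij : x i = x j
    · simp [hgdef, hij]
    · have h1 := hg i j hij
      have h0 : 0 ≤ c * M := by positivity
      have h3 : (g i - g j) ^ 2 ≤ 1 := by
        simp only [hgdef]
        split_ifs <;> norm_num
      nlinarith
  simp only [← Finset.mul_sum] at hle
  rw [aux_double, aux_double, ← aux_mean e x (by linarith)] at hle
  have hgsq : ∑ i ∈ e, g i ^ 2 = ∑ i ∈ e, g i := by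
    refine Finset.sum_congr rfl fun i _ => ?_
    simp only [hgdef]
    split_ifs <;> norm_num
  have hg0 : ∀ i, 0 ≤ g i := fun i => by
    simp only [hgdef]
    split_ifs <;> norm_num
  have hg1 : ∀ i, 0 ≤ 1 - g i := fun i => by
    simp only [hgdef]
    split_ifs <;> norm_num
  have ha : 1 ≤ ∑ i ∈ e, g i := by
    have := Finset.single_le_sum (f := g) (fun i _ => hg0 i) hp
    simpa [hgdef] using this
  have hb : 1 ≤ (e.card : ℝ) - ∑ i ∈ e, g i := by
    have h := Finset.single_le_sum (f := fun i => 1 - g i) (fun i _ => hg1 i) hq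
    rw [Finset.sum_sub_distrib, Finset.sum_const, nsmul_eq_mul, mul_one] at h
    have hgq : g q = 0 := by
      simp only [hgdef]
      rw [if_neg (Ne.symm hpq)]
    simp only [hgq] at h
    linarith
  rw [hgsq] at hle
  set a := ∑ i ∈ e, g i
  set n : ℝ := (e.card : ℝ)
  have hab : n - 1 ≤ n * a - a ^ 2 := by nlinarith
  unfold disc
  rw [le_div_iff₀ (by linarith)]
  have hS : c * M * (n - 1) ≤ n * ∑ i ∈ e, (x i - hmean e x) ^ 2 := by
    have : c * M * (n - 1) ≤ c * M * (n * a - a ^ 2) :=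
      mul_le_mul_of_nonneg_left hab (by positivity)
    linarith
  have hS2 : n * (c * (n - 1)) ≤ c * M * (n - 1) := by
    have : 0 ≤ c * (n - 1) := mul_nonneg hc.le (by linarith)
    nlinarith
  exact le_of_mul_le_mul_left (hS2.trans hS) (by linarith)

end
end

section
/- Let V be a finite set of nodes and let ẽ ⊆ V be a nonempty subset. Then there exists a finite sequence ẽ_1, ..., ẽ_m of subsets of V, each of prime cardinality, such that for every opinion state x ∈ ℝ^V, applying the mean-update operation successively for ẽ_1, ..., ẽ_m yields the same state as applying the mean-update operation for ẽ once. -/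
open MeasureTheory ProbabilityTheory Filter Finset
open scoped ENNReal NNReal

noncomputable section

/-- The mean-update operation: every node of `e` adopts the mean opinion of `e`
(no confidence-bound condition is imposed). -/
def meanUpdate {N : ℕ} (e : Finset (Fin N)) (x : Fin N → ℝ) : Fin N → ℝ :=
  fun i => if i ∈ e then hmean e x else x i


theorem aux_expand {N : ℕ} (M : List (Finset (Fin N)))
    (h : ∀ e ∈ M, ∃ L : List (Finset (Fin N)), (∀ f ∈ L, f.card.Prime) ∧
      ∀ x : Fin N → ℝ, L.foldl (fun y f => meanUpdate f y) x = meanUpdate e x) :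
    ∃ L : List (Finset (Fin N)), (∀ f ∈ L, f.card.Prime) ∧
      ∀ x : Fin N → ℝ, L.foldl (fun y f => meanUpdate f y) x =
        M.foldl (fun y f => meanUpdate f y) x := by
  induction M with
  | nil => exact ⟨[], by simp, by simp⟩
  | cons e M ih =>
    obtain ⟨L1, h1, h1'⟩ := h e (by simp)
    obtain ⟨L2, h2, h2'⟩ := ih (fun f hf => h f (by simp [hf]))
    refine ⟨L1 ++ L2, ?_, ?_⟩
    · intro f hf
      rcases List.mem_append.1 hf with hf | hf
      · exact h1 f hf
      · exact h2 f hf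
    · intro x
      rw [List.foldl_append, h1', h2', List.foldl_cons]

theorem aux_none {N : ℕ} (M : List (Finset (Fin N))) (x : Fin N → ℝ) (v : Fin N)
    (hv : ∀ f ∈ M, v ∉ f) : M.foldl (fun y f => meanUpdate f y) x v = x v := by
  induction M generalizing x with
  | nil => rfl
  | cons e M ih =>
    rw [List.foldl_cons, ih _ (fun f hf => hv f (by simp [hf]))]
    have := hv e (by simp)
    simp [meanUpdate, this]

theorem aux_some {N : ℕ} (M : List (Finset (Fin N))) (hM : M.Pairwise Disjoint)
    (x : Fin N → ℝ) (v : Fin N) (f : Finset (Fin N)) (hf : f ∈ M) (hv : v ∈ f) :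
    M.foldl (fun y f => meanUpdate f y) x v = hmean f x := by
  induction M generalizing x with
  | nil => simp at hf
  | cons e M ih =>
    rw [List.pairwise_cons] at hM
    rw [List.foldl_cons]
    rcases List.mem_cons.1 hf with rfl | hf
    · rw [aux_none]
      · simp [meanUpdate, hv]
      · intro g hg hvg
        exact Finset.disjoint_left.1 (hM.1 g hg) hv hvg
    · rw [ih hM.2 _ hf]
      unfold hmean
      congr 1
      refine Finset.sum_congr rfl fun i hi => ?_
      have : i ∉ e := fun hie => Finset.disjoint_left.1 (hM.1 f hf) hie hi
      simp [meanUpdate, this]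

theorem aux_grid {N a b : ℕ} (ha : a ≠ 0) (hb : b ≠ 0) (e : Finset (Fin N))
    (g : Fin a × Fin b → Fin N) (hg : Function.Injective g)
    (hge : Finset.univ.image g = e) (x : Fin N → ℝ) :
    (List.ofFn (fun i : Fin a => Finset.univ.image (fun j : Fin b => g (i, j))) ++
      List.ofFn (fun j : Fin b => Finset.univ.image (fun i : Fin a => g (i, j)))).foldl
      (fun y f => meanUpdate f y) x = meanUpdate e x := by
  have hr : ∀ i : Fin a, Function.Injective (fun j : Fin b => g (i, j)) := fun i j k h => by
    simpa using hg h
  have hc : ∀ j : Fin b, Function.Injective (fun i : Fin a => g (i, j)) := fun i j k h => by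
    simpa using hg h
  have hrow : ∀ i j, (List.ofFn (fun i : Fin a =>
      Finset.univ.image (fun j : Fin b => g (i, j)))).foldl
      (fun y f => meanUpdate f y) x (g (i, j)) = (∑ k, x (g (i, k))) / b := by
    intro i j
    rw [aux_some _ ?_ x _ (Finset.univ.image (fun j : Fin b => g (i, j)))]
    · unfold hmean
      rw [Finset.sum_image (fun _ _ _ _ h => hr i h), Finset.card_image_of_injective _ (hr i)]
      simp
    · exact List.mem_ofFn.2 ⟨i, rfl⟩
    · simp
    · rw [List.pairwise_ofFn]
      intro i k hik
      rw [Finset.disjoint_left]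
      intro v hv hv'
      simp only [Finset.mem_image, Finset.mem_univ, true_and] at hv hv'
      obtain ⟨p, rfl⟩ := hv
      obtain ⟨q, hq⟩ := hv'
      have := hg hq
      simp only [Prod.mk.injEq] at this
      exact hik.ne this.1.symm
  rw [List.foldl_append]
  funext v
  by_cases hv : v ∈ e
  · have hv' := hv
    rw [← hge] at hv'
    simp only [Finset.mem_image, Finset.mem_univ, true_and] at hv'
    obtain ⟨⟨i, j⟩, rfl⟩ := hv'
    rw [aux_some _ ?_ _ _ (Finset.univ.image (fun i : Fin a => g (i, j)))]
    · simp only [meanUpdate, hv, if_true]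
      unfold hmean
      rw [Finset.sum_image (fun _ _ _ _ h => hc j h), Finset.card_image_of_injective _ (hc j)]
      have h2 : ∑ i ∈ e, x i = ∑ i, ∑ k, x (g (i, k)) := by
        rw [← hge, Finset.sum_image (fun _ _ _ _ h => hg h), Fintype.sum_prod_type]
      have h3 : e.card = a * b := by
        rw [← hge, Finset.card_image_of_injective _ hg]; simp
      rw [h2, h3]
      rw [Finset.sum_congr rfl (fun i _ => hrow i j)]
      rw [← Finset.sum_div, div_div]
      simp [mul_comm]
    · exact List.mem_ofFn.2 ⟨j, rfl⟩
    · simp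
    · rw [List.pairwise_ofFn]
      intro i k hik
      rw [Finset.disjoint_left]
      intro v hv hv'
      simp only [Finset.mem_image, Finset.mem_univ, true_and] at hv hv'
      obtain ⟨p, rfl⟩ := hv
      obtain ⟨q, hq⟩ := hv'
      have := hg hq
      simp only [Prod.mk.injEq] at this
      exact hik.ne this.2.symm
  · have hn : ∀ p, g p ≠ v := fun p hp => hv (by rw [← hge, ← hp]; simp)
    rw [aux_none, aux_none]
    · simp [meanUpdate, hv]
    · intro f hf
      obtain ⟨i, rfl⟩ := List.mem_ofFn.1 hf
      simp [hn]
    · intro f hf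
      obtain ⟨i, rfl⟩ := List.mem_ofFn.1 hf
      simp [hn]

theorem aux_main (N n : ℕ) : ∀ e : Finset (Fin N), e.Nonempty → e.card = n →
    ∃ L : List (Finset (Fin N)), (∀ f ∈ L, f.card.Prime) ∧
      ∀ x : Fin N → ℝ, L.foldl (fun y f => meanUpdate f y) x = meanUpdate e x := by
  induction n using Nat.strong_induction_on with
  | _ n ih =>
  intro e he hn
  have hpos : 0 < n := hn ▸ he.card_pos
  by_cases h1 : n = 1
  · refine ⟨[], by simp, fun x => ?_⟩
    obtain ⟨v, rfl⟩ := Finset.card_eq_one.1 (hn.trans h1)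
    funext w
    by_cases hw : w = v
    · subst hw; simp [meanUpdate, hmean]
    · simp [meanUpdate, hw]
  by_cases hp : n.Prime
  · exact ⟨[e], by simpa [hn] using hp, by simp⟩
  obtain ⟨a, b, ha, hb, hab⟩ := (Nat.not_prime_iff_exists_mul_eq (by omega)).1 hp
  have ha0 : a ≠ 0 := by rintro rfl; omega
  have hb0 : b ≠ 0 := by rintro rfl; omega
  let φ : Fin a × Fin b ≃ e := finProdFinEquiv.trans
    ((finCongr (hab.trans hn.symm)).trans e.equivFin.symm)
  let g : Fin a × Fin b → Fin N := fun p => (φ p : Fin N)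
  have hg : Function.Injective g := Subtype.val_injective.comp φ.injective
  have hge : Finset.univ.image g = e := by
    ext v
    simp only [Finset.mem_image, Finset.mem_univ, true_and]
    constructor
    · rintro ⟨p, rfl⟩; exact (φ p).2
    · intro hv; exact ⟨φ.symm ⟨v, hv⟩, by simp [g]⟩
  obtain ⟨L, hL, hL'⟩ := aux_expand
    (List.ofFn (fun i : Fin a => Finset.univ.image (fun j : Fin b => g (i, j))) ++
      List.ofFn (fun j : Fin b => Finset.univ.image (fun i : Fin a => g (i, j)))) (by
    intro f hf
    rcases List.mem_append.1 hf with hf | hf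
    · obtain ⟨i, rfl⟩ := List.mem_ofFn.1 hf
      refine ih b hb _ ⟨g (i, ⟨0, by omega⟩), by simp⟩ ?_
      rw [Finset.card_image_of_injective _ (fun j k h => by simpa using hg h)]
      simp
    · obtain ⟨j, rfl⟩ := List.mem_ofFn.1 hf
      refine ih a ha _ ⟨g (⟨0, by omega⟩, j), by simp⟩ ?_
      rw [Finset.card_image_of_injective _ (fun i k h => by simpa using hg h)]
      simp)
  exact ⟨L, hL, fun x => (hL' x).trans (aux_grid ha0 hb0 e g hg hge x)⟩

/-- For every nonempty subset `e` of the nodes, there is a finite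
sequence of subsets, each of prime cardinality, such that successively applying the
mean-update operation along the sequence has the same effect on every opinion state
as a single mean-update on `e`. -/
theorem stmt12 (N : ℕ) (e : Finset (Fin N)) (he : e.Nonempty) :
    ∃ L : List (Finset (Fin N)), (∀ f ∈ L, f.card.Prime) ∧
      ∀ x : Fin N → ℝ, L.foldl (fun y f => meanUpdate f y) x = meanUpdate e x := by
  exact aux_main N _ e he rfl

end
end

section
/- Let H=(V,E) be a hypergraph on N nodes and let c > 0. Suppose there is a subset e = {i_1, ..., i_p} ⊆ V with e ∉ E such that p = |e| is prime and the subhypergraph of H induced by e (whose node set is e and whose hyperedges are {e' ∈ E : e' ⊆ e}) is connected (this forces p ≥ 3). Then there exists an initial opinion state x(0) ∈ ℝ^N such that for every sequence e_0, e_1, ... of hyperedges in E, the resulting opinion state never converges in finite time: there is no time T at which x(T) is an absorbing state. -/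
open MeasureTheory ProbabilityTheory Filter Finset
open scoped ENNReal NNReal

noncomputable section

theorem aux_disc_ge {N : ℕ} (e : Finset (Fin N)) (x : Fin N → ℝ) (c D : ℝ) (he : 2 ≤ e.card)
    (i j : Fin N) (hi : i ∈ e) (hj : j ∈ e) (hij : i ≠ j) (hD : 0 ≤ D)
    (h : D ≤ |x i - x j|) (hcD : 2 * c * ((e.card : ℝ) - 1) ≤ D ^ 2) : c ≤ disc e x := by
  have hc2 : (2 : ℝ) ≤ e.card := by exact_mod_cast he
  unfold disc
  rw [le_div_iff₀ (by linarith)]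
  set m := hmean e x
  have h1 : ∑ k ∈ ({i, j} : Finset (Fin N)), (x k - m) ^ 2 ≤ ∑ k ∈ e, (x k - m) ^ 2 := by
    apply Finset.sum_le_sum_of_subset_of_nonneg
    · intro k hk
      simp only [Finset.mem_insert, Finset.mem_singleton] at hk
      rcases hk with rfl | rfl <;> assumption
    · intros; positivity
  rw [Finset.sum_pair hij] at h1
  have h2 : D ^ 2 ≤ (x i - x j) ^ 2 := by
    rw [← sq_abs (x i - x j)]
    gcongr
  nlinarith [sq_nonneg ((x i - m) + (x j - m))]

theorem aux_mean_s14 {N : ℕ} (e : Finset (Fin N)) (x : Fin N → ℝ) (d : ℝ) (he : 2 ≤ e.card)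
    (h : ∀ i ∈ e, 0 ≤ x i ∧ x i ≤ d) : 0 ≤ hmean e x ∧ hmean e x ≤ d := by
  have hc2 : (2 : ℝ) ≤ e.card := by exact_mod_cast he
  unfold hmean
  constructor
  · exact div_nonneg (Finset.sum_nonneg fun i hi => (h i hi).1) (by linarith)
  · rw [div_le_iff₀ (by linarith)]
    have := Finset.sum_le_card_nsmul e x d (fun i hi => (h i hi).2)
    rw [nsmul_eq_mul] at this
    linarith

theorem aux_disc_lt {N : ℕ} (e : Finset (Fin N)) (x : Fin N → ℝ) (d : ℝ) (hd : 0 < d)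
    (he : 2 ≤ e.card)
    (h : ∀ i ∈ e, 0 ≤ x i ∧ x i ≤ d) : disc e x < 4 * d ^ 2 := by
  have hc2 : (2 : ℝ) ≤ e.card := by exact_mod_cast he
  obtain ⟨hm0, hm1⟩ := aux_mean_s14 e x d he h
  unfold disc
  rw [div_lt_iff₀ (by linarith)]
  have := Finset.sum_le_card_nsmul e (fun i => (x i - hmean e x) ^ 2) (d ^ 2) (fun i hi => by
    have := h i hi
    apply sq_le_sq'  <;> linarith)
  rw [nsmul_eq_mul] at this
  have hd2 : 0 < d ^ 2 := by positivity
  nlinarith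

/-- The invariant of the trajectory. -/
def AuxInv {N : ℕ} (e0 : Finset (Fin N)) (d M : ℝ) (x : Fin N → ℝ) : Prop :=
  (∀ i, i ∉ e0 → x i = M * ((i : ℕ) + 1)) ∧ (∀ i ∈ e0, 0 ≤ x i ∧ x i ≤ d) ∧
  (∑ i ∈ e0, x i = d) ∧
  ∃ m : ℕ, Nat.Coprime e0.card m ∧ ∀ i ∈ e0, ∃ z : ℤ, (m : ℝ) * x i = d * z

theorem aux_far {N : ℕ} (e0 e : Finset (Fin N)) (d D c : ℝ) (hd : 0 < d) (hD : 0 ≤ D)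
    (hc : 0 < c)
    (hcD : 2 * c * N ≤ D ^ 2) (x : Fin N → ℝ) (hx : AuxInv e0 d (d + D) x)
    (he : 2 ≤ e.card) (hs : ¬ e ⊆ e0) : c ≤ disc e x := by
  obtain ⟨i, hi, hi0⟩ := Finset.not_subset.1 hs
  obtain ⟨j, hj, hji⟩ := Finset.exists_mem_ne (by omega : 1 < e.card) i
  have hN : (e.card : ℝ) ≤ N := by
    have := Finset.card_le_univ e
    rw [Fintype.card_fin] at this
    exact_mod_cast this
  refine aux_disc_ge e x c D he i j hi hj hji.symm hD ?_ (by nlinarith)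
  have hxi := hx.1 i hi0
  by_cases hj0 : j ∈ e0
  · have := hx.2.1 j hj0
    have h0 : (0 : ℝ) ≤ ((i : ℕ) : ℝ) := by positivity
    refine le_trans ?_ (le_abs_self _)
    rw [hxi]
    nlinarith
  · rw [hxi, hx.1 j hj0]
    have hne : (i : ℕ) ≠ (j : ℕ) := fun h => hji (Fin.ext h.symm)
    rcases lt_or_gt_of_ne hne with h | h
    · have h' : ((i : ℕ) : ℝ) + 1 ≤ ((j : ℕ) : ℝ) := by exact_mod_cast h
      refine le_trans ?_ (neg_le_abs _)
      nlinarith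
    · have h' : ((j : ℕ) : ℝ) + 1 ≤ ((i : ℕ) : ℝ) := by exact_mod_cast h
      refine le_trans ?_ (le_abs_self _)
      nlinarith

theorem aux_step {N : ℕ} (e0 e : Finset (Fin N)) (d D c : ℝ) (hd : 0 < d) (hD : 0 ≤ D)
    (hc : 0 < c)
    (hcD : 2 * c * N ≤ D ^ 2) (x : Fin N → ℝ) (hx : AuxInv e0 d (d + D) x)
    (he : 2 ≤ e.card) (hne : e ≠ e0) (hp : e0.card.Prime) :
    AuxInv e0 d (d + D) (bcmStep c e x) := by
  unfold bcmStep
  split_ifs with hlt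
  swap
  · exact hx
  have hs : e ⊆ e0 := by
    by_contra hs
    exact absurd (aux_far e0 e d D c hd hD hc hcD x hx he hs) (not_le.2 hlt)
  obtain ⟨h1, h2, h3, m, hm, h4⟩ := hx
  have hmn := aux_mean_s14 e x d he (fun i hi => h2 i (hs hi))
  have hc2 : (2 : ℝ) ≤ e.card := by exact_mod_cast he
  have hmul : (e.card : ℝ) * hmean e x = ∑ i ∈ e, x i := by
    unfold hmean
    field_simp
  refine ⟨?_, ?_, ?_, ?_⟩
  · intro i hi
    simp only
    rw [if_neg (fun h => hi (hs h))]
    exact h1 i hi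
  · intro i hi
    simp only
    split_ifs
    · exact hmn
    · exact h2 i hi
  · rw [← h3, ← Finset.sum_sdiff hs, ← Finset.sum_sdiff (f := x) hs]
    congr 1
    · apply Finset.sum_congr rfl
      intro i hi
      rw [if_neg (Finset.mem_sdiff.1 hi).2]
    · rw [Finset.sum_congr rfl (fun i hi => if_pos hi), Finset.sum_const, nsmul_eq_mul, hmul]
  · refine ⟨m * e.card, ?_, ?_⟩
    · refine Nat.Coprime.mul_right hm ?_
      refine (Nat.Prime.coprime_iff_not_dvd hp).2 (fun hdvd => ?_)
      exact absurd (Nat.le_of_dvd (by omega) hdvd)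
        (not_le.2 (Finset.card_lt_card (Finset.ssubset_iff_subset_ne.2 ⟨hs, hne⟩)))
    · choose! z hz using h4
      intro i hi
      simp only
      push_cast
      split_ifs with hie
      · refine ⟨∑ k ∈ e, z k, ?_⟩
        rw [mul_assoc, hmul, Finset.mul_sum, Int.cast_sum, Finset.mul_sum]
        exact Finset.sum_congr rfl (fun k hk => hz k (hs hk))
      · refine ⟨z i * e.card, ?_⟩
        push_cast
        rw [mul_right_comm, hz i hi]
        ring

/-- Suppose some subset `e0` of prime cardinality is *not* a hyperedge
of `H`, yet the subhypergraph induced by `e0` (with hyperedges the members of `E`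
contained in `e0`) is connected. Then there is an initial opinion state from which, for
every sequence of selected hyperedges, the opinion state never reaches an absorbing
state in finite time. -/
theorem stmt14 (N : ℕ) (E : Finset (Finset (Fin N))) (hE : ∀ e ∈ E, 2 ≤ e.card)
    (c : ℝ) (hc : 0 < c) (e0 : Finset (Fin N)) (he0 : e0 ∉ E) (hp : e0.card.Prime)
    (hconn : ∀ i ∈ e0, ∀ j ∈ e0,
      Relation.ReflTransGen
        (fun u v => ∃ e' ∈ E, e' ⊆ e0 ∧ u ∈ e' ∧ v ∈ e') i j) :
    ∃ x0 : Fin N → ℝ, ∀ es : ℕ → Finset (Fin N), (∀ t, es t ∈ E) →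
      ∀ T : ℕ, ¬ IsAbsorbing c E (bcmTraj c x0 es T) := by
  have hs : 0 < Real.sqrt c := Real.sqrt_pos.2 hc
  have hss : Real.sqrt c ^ 2 = c := Real.sq_sqrt hc.le
  obtain ⟨d, hd⟩ : ∃ d, d = Real.sqrt c / 2 := ⟨_, rfl⟩
  obtain ⟨D, hD⟩ : ∃ D, D = 2 * Real.sqrt c * N := ⟨_, rfl⟩
  have hd0 : 0 < d := by rw [hd]; positivity
  have hD0 : 0 ≤ D := by rw [hD]; positivity
  have hdc : 4 * d ^ 2 = c := by rw [hd]; linarith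
  have hcD : 2 * c * N ≤ D ^ 2 := by
    rw [hD, mul_pow, mul_pow, hss]
    have : (N : ℝ) ≤ (N : ℝ) ^ 2 := by exact_mod_cast Nat.le_self_pow two_ne_zero N
    nlinarith
  obtain ⟨a, ha⟩ := Finset.card_pos.1 hp.pos
  refine ⟨fun i => if i ∈ e0 then (if i = a then d else 0) else (d + D) * ((i : ℕ) + 1), ?_⟩
  intro es hes T
  have hinv : AuxInv e0 d (d + D) (bcmTraj c (fun i => if i ∈ e0 then (if i = a then d else 0)
      else (d + D) * ((i : ℕ) + 1)) es T) := by
    induction T with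
    | zero =>
      simp only [bcmTraj]
      refine ⟨?_, ?_, ?_, 1, Nat.coprime_one_right _, ?_⟩
      · intro i hi
        simp [hi]
      · intro i hi
        simp only [hi, if_true]
        split_ifs
        · exact ⟨hd0.le, le_rfl⟩
        · exact ⟨le_rfl, hd0.le⟩
      · rw [Finset.sum_congr rfl (fun i hi => if_pos hi)]
        simp [ha]
      · intro i hi
        simp only [hi, if_true]
        split_ifs
        · exact ⟨1, by simp⟩
        · exact ⟨0, by simp⟩
    | succ t ih =>
      exact aux_step e0 (es t) d D c hd0 hD0 hc hcD _ ih (hE _ (hes t))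
        (fun h => he0 (h ▸ hes t)) hp
  generalize bcmTraj c _ es T = x at hinv
  intro habs
  have heq : ∀ j, Relation.ReflTransGen
        (fun u v => ∃ e' ∈ E, e' ⊆ e0 ∧ u ∈ e' ∧ v ∈ e') a j → x a = x j := by
    intro j hj
    induction hj with
    | refl => rfl
    | tail _ h ih =>
      obtain ⟨e', he', hsub, hu, hv⟩ := h
      rw [ih]
      rcases habs e' he' with h | h
      · have := aux_disc_lt e' x d hd0 (hE _ he') (fun i hi => hinv.2.1 i (hsub hi))
        linarith
      · exact h _ hu _ hv
  obtain ⟨-, -, h3, m, hm, h4⟩ := hinv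
  obtain ⟨z, hz⟩ := h4 a ha
  rw [Finset.sum_congr rfl (fun j hj => (heq j (hconn a ha j hj)).symm), Finset.sum_const,
    nsmul_eq_mul] at h3
  have h5 : d * (m : ℝ) = d * ((e0.card : ℝ) * z) := by
    calc d * (m : ℝ) = e0.card * (m * x a) := by rw [← h3]; ring
      _ = _ := by rw [hz]; ring
  have h6 : (m : ℝ) = (e0.card : ℝ) * z := mul_left_cancel₀ hd0.ne' h5
  have h7 : (m : ℤ) = (e0.card : ℤ) * z := by exact_mod_cast h6
  have h8 : e0.card ∣ m := by
    have : (e0.card : ℤ) ∣ (m : ℤ) := ⟨z, h7⟩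
    exact_mod_cast this
  exact (Nat.Prime.coprime_iff_not_dvd hp).1 hm h8

end
end
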